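/- Let C and T be compact operators on a complex Hilbert space H, let α > 0, and suppose lim_{n→∞} n^α s_n(C) = a with 0 ≤ a < ∞ and lim_{n→∞} n^{1/q} s_n(T) = 0 for some q with α ≤ 1/q. Then lim_{n→∞} n^α s_n(C + T) = a. -/

import Mathlib

open Filter Topology

/-- The `n`-th singular value (`s`-number) of an operator on a Hilbert space,
indexed so that `sNum T 1 = ‖T‖`: `sNum T n` is the distance from `T` to the
operators of rank `< n`. -/
noncomputable def sNum {H : Type*} [NormedAddCommGroup H] [InnerProductSpace ℂ H]
    (T : H →L[ℂ] H) (n : ℕ) : ℝ :=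
  ⨅ F : {F : H →L[ℂ] H // Module.rank ℂ (LinearMap.range (F : H →ₗ[ℂ] H)) < (n : Cardinal)},
    ‖T - (F : H →L[ℂ] H)‖

theorem sNum_nonempty {H : Type*} [NormedAddCommGroup H] [InnerProductSpace ℂ H] (n : ℕ)
    (hn : 0 < n) : Nonempty {F : H →L[ℂ] H //
      Module.rank ℂ (LinearMap.range (F : H →ₗ[ℂ] H)) < (n : Cardinal)} := by
  refine ⟨⟨0, ?_⟩⟩
  have h : LinearMap.range ((0 : H →L[ℂ] H) : H →ₗ[ℂ] H) = ⊥ := by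
    simp
  rw [h, rank_bot]
  exact_mod_cast hn

theorem sNum_bdd {H : Type*} [NormedAddCommGroup H] [InnerProductSpace ℂ H]
    (T : H →L[ℂ] H) (n : ℕ) : BddBelow (Set.range
      (fun F : {F : H →L[ℂ] H //
        Module.rank ℂ (LinearMap.range (F : H →ₗ[ℂ] H)) < (n : Cardinal)} =>
          ‖T - (F : H →L[ℂ] H)‖)) :=
  ⟨0, by rintro _ ⟨F, rfl⟩; exact norm_nonneg _⟩

theorem sNum_nonneg {H : Type*} [NormedAddCommGroup H] [InnerProductSpace ℂ H]
    (T : H →L[ℂ] H) (n : ℕ) : 0 ≤ sNum T n :=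
  Real.iInf_nonneg fun _ => norm_nonneg _

theorem card_add_lt {a b : Cardinal} {n m : ℕ} (ha : a < n) (hb : b < m) :
    a + b < ((n + m : ℕ) : Cardinal) := by
  obtain ⟨k, rfl⟩ := Cardinal.lt_aleph0.1 (ha.trans Cardinal.natCast_lt_aleph0)
  obtain ⟨l, rfl⟩ := Cardinal.lt_aleph0.1 (hb.trans Cardinal.natCast_lt_aleph0)
  norm_cast at *
  omega

/-- Ky Fan inequality. -/
theorem sNum_add {H : Type*} [NormedAddCommGroup H] [InnerProductSpace ℂ H]
    (A B : H →L[ℂ] H) (n m : ℕ) (hn : 0 < n) (hm : 0 < m) :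
    sNum (A + B) (n + m) ≤ sNum A n + sNum B m := by
  have := sNum_nonempty (H := H) n hn
  have := sNum_nonempty (H := H) m hm
  refine le_ciInf_add_ciInf ?_
  rintro ⟨F, hF⟩ ⟨G, hG⟩
  have hr : Module.rank ℂ (LinearMap.range ((F + G : H →L[ℂ] H) : H →ₗ[ℂ] H))
      < ((n + m : ℕ) : Cardinal) := by
    refine lt_of_le_of_lt ?_ (card_add_lt hF hG)
    exact LinearMap.rank_add_le (F : H →ₗ[ℂ] H) (G : H →ₗ[ℂ] H)
  refine (ciInf_le (sNum_bdd (A + B) (n + m)) ⟨F + G, hr⟩).trans ?_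
  calc ‖A + B - (F + G)‖ = ‖(A - F) + (B - G)‖ := by congr 1; abel
    _ ≤ _ := norm_add_le _ _

theorem sNum_neg_le {H : Type*} [NormedAddCommGroup H] [InnerProductSpace ℂ H]
    (T : H →L[ℂ] H) (n : ℕ) (hn : 0 < n) : sNum (-T) n ≤ sNum T n := by
  have := sNum_nonempty (H := H) n hn
  refine le_ciInf ?_
  rintro ⟨F, hF⟩
  have hr : Module.rank ℂ (LinearMap.range ((-F : H →L[ℂ] H) : H →ₗ[ℂ] H)) < (n : Cardinal) := by
    have : ((-F : H →L[ℂ] H) : H →ₗ[ℂ] H) = -(F : H →ₗ[ℂ] H) := rfl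
    rw [this, LinearMap.range_neg]
    exact hF
  refine (ciInf_le (sNum_bdd (-T) n) ⟨-F, hr⟩).trans ?_
  rw [← norm_neg]
  apply le_of_eq
  congr 1
  simp only
  abel

theorem tendsto_idx {j : ℕ → ℕ} {c : ℝ} (hc : 0 < c)
    (hj : Tendsto (fun N : ℕ => (j N : ℝ) / N) atTop (𝓝 c)) : Tendsto j atTop atTop := by
  rw [← tendsto_natCast_atTop_iff (R := ℝ)]
  have h := hj.pos_mul_atTop hc (tendsto_natCast_atTop_atTop (R := ℝ))
  refine h.congr' ?_
  filter_upwards [eventually_gt_atTop 0] with N hN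
  have : (N : ℝ) ≠ 0 := by positivity
  field_simp

theorem tendsto_sub {u : ℕ → ℝ} {j : ℕ → ℕ} {c α L : ℝ} (hc : 0 < c)
    (hj : Tendsto (fun N : ℕ => (j N : ℝ) / N) atTop (𝓝 c))
    (hu : Tendsto (fun n : ℕ => (n : ℝ) ^ α * u n) atTop (𝓝 L)) :
    Tendsto (fun N : ℕ => (N : ℝ) ^ α * u (j N)) atTop (𝓝 (c ^ (-α) * L)) := by
  have hj' := tendsto_idx hc hj
  have h1 := (hj.rpow_const (p := -α) (Or.inl hc.ne')).mul (hu.comp hj')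
  refine h1.congr' ?_
  filter_upwards [eventually_gt_atTop 0, hj'.eventually_gt_atTop 0] with N hN hjN
  have hN' : (0 : ℝ) < N := by exact_mod_cast hN
  have hjN' : (0 : ℝ) < j N := by exact_mod_cast hjN
  have := Real.rpow_pos_of_pos hjN' α
  have := Real.rpow_pos_of_pos hN' α
  simp only [Function.comp]
  rw [Real.rpow_neg (by positivity), Real.div_rpow hjN'.le hN'.le]
  field_simp

/-- If `C`, `T` are compact, `n ^ α * s n (C) → a` with `0 ≤ a < ∞`, and
`n ^ (1/q) * s n (T) → 0` for some `q` with `α ≤ 1/q`, then `n ^ α * s n (C + T) → a`. -/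
theorem statement14 {H : Type*} [NormedAddCommGroup H] [InnerProductSpace ℂ H]
    [CompleteSpace H] (C T : H →L[ℂ] H)
    (hCcompact : IsCompactOperator (⇑C)) (hTcompact : IsCompactOperator (⇑T))
    (α a q : ℝ) (hα0 : 0 < α) (ha0 : 0 ≤ a) (hq0 : 0 < q) (hαq : α ≤ 1 / q)
    (hC : Tendsto (fun n : ℕ => (n : ℝ) ^ α * sNum C n) atTop (𝓝 a))
    (hT : Tendsto (fun n : ℕ => (n : ℝ) ^ (1 / q) * sNum T n) atTop (𝓝 0)) :
    Tendsto (fun n : ℕ => (n : ℝ) ^ α * sNum (C + T) n) atTop (𝓝 a) := by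
  have hT' : Tendsto (fun n : ℕ => (n : ℝ) ^ α * sNum T n) atTop (𝓝 0) := by
    refine squeeze_zero' (Eventually.of_forall fun n =>
      mul_nonneg (by positivity) (sNum_nonneg T n)) ?_ hT
    filter_upwards [eventually_ge_atTop 1] with n hn
    exact mul_le_mul_of_nonneg_right
      (Real.rpow_le_rpow_of_exponent_le (by exact_mod_cast hn) hαq) (sNum_nonneg T n)
  have hfl : ∀ δ : ℝ, 0 < δ →
      Tendsto (fun N : ℕ => ((⌊δ * (N : ℝ)⌋₊ : ℕ) : ℝ) / N) atTop (𝓝 δ) := fun δ hδ =>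
    (tendsto_nat_floor_mul_div_atTop hδ.le).comp (tendsto_natCast_atTop_atTop (R := ℝ))
  have hone : ∀ᶠ N : ℕ in atTop, (N : ℝ) / N = 1 := by
    filter_upwards [eventually_gt_atTop 0] with N hN
    have : (N : ℝ) ≠ 0 := by positivity
    field_simp
  have hlim1 : Tendsto (fun N : ℕ => (N : ℝ) / N) atTop (𝓝 1) :=
    tendsto_const_nhds.congr' (hone.mono fun _ h => h.symm)
  have hδ0 : ∀ s : ℝ, Tendsto (fun δ : ℝ => (1 + s * δ) ^ (-α) * a) (𝓝[>] 0) (𝓝 a) := by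
    intro s
    have h : ContinuousAt (fun δ : ℝ => (1 + s * δ) ^ (-α) * a) 0 := by
      refine ContinuousAt.mul (ContinuousAt.rpow_const (by fun_prop) (Or.inl (by simp)))
        continuousAt_const
    have h2 := h.tendsto
    simp only [mul_zero, add_zero, Real.one_rpow, one_mul] at h2
    exact h2.mono_left nhdsWithin_le_nhds
  have hsmall : ∀ᶠ δ : ℝ in 𝓝[>] 0, 0 < δ ∧ δ < 1 := Ioo_mem_nhdsGT one_pos
  rw [tendsto_order]
  constructor
  · intro b hb
    obtain ⟨δ, hδb, hδp, hδ1⟩ := (((hδ0 1).eventually_const_lt hb).and hsmall).exists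
    rw [one_mul] at hδb
    have hm := hfl δ hδp
    have hj : Tendsto (fun N : ℕ => ((N + ⌊δ * (N : ℝ)⌋₊ : ℕ) : ℝ) / N) atTop (𝓝 (1 + δ)) := by
      refine (hlim1.add hm).congr fun N => ?_
      push_cast; ring
    have h := (tendsto_sub (by linarith) hj hC).sub (tendsto_sub hδp hm hT')
    rw [mul_zero, sub_zero] at h
    filter_upwards [h.eventually_const_lt hδb, eventually_gt_atTop 0,
      (tendsto_idx hδp hm).eventually_gt_atTop 0] with N h1 hN hmN
    refine h1.trans_le ?_
    have hk := sNum_add (C + T) (-T) N _ hN hmN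
    rw [add_neg_cancel_right] at hk
    have hk2 := hk.trans (add_le_add_right (sNum_neg_le T _ hmN) _)
    have := mul_le_mul_of_nonneg_left hk2 (by positivity : (0 : ℝ) ≤ (N : ℝ) ^ α)
    linarith
  · intro b hb
    obtain ⟨δ, hδb, hδp, hδ1⟩ := (((hδ0 (-1)).eventually_lt_const hb).and hsmall).exists
    have hm := hfl δ hδp
    have hle : ∀ N : ℕ, ⌊δ * (N : ℝ)⌋₊ ≤ N := fun N =>
      Nat.floor_le_of_le (by nlinarith [(Nat.cast_nonneg N : (0 : ℝ) ≤ N)])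
    have hj : Tendsto (fun N : ℕ => ((N - ⌊δ * (N : ℝ)⌋₊ : ℕ) : ℝ) / N) atTop
        (𝓝 (1 + -1 * δ)) := by
      have h := hlim1.sub hm
      rw [show 1 - δ = 1 + -1 * δ by ring] at h
      refine h.congr fun N => ?_
      rw [Nat.cast_sub (hle N)]; ring
    have hpos : 0 < 1 + -1 * δ := by linarith
    have h := (tendsto_sub hpos hj hC).add (tendsto_sub hδp hm hT')
    rw [mul_zero, add_zero] at h
    filter_upwards [h.eventually_lt_const hδb, (tendsto_idx hpos hj).eventually_gt_atTop 0,
      (tendsto_idx hδp hm).eventually_gt_atTop 0] with N h1 hN hmN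
    refine lt_of_le_of_lt ?_ h1
    have hk := sNum_add C T _ _ hN hmN
    rw [Nat.sub_add_cancel (hle N)] at hk
    have := mul_le_mul_of_nonneg_left hk (by positivity : (0 : ℝ) ≤ (N : ℝ) ^ α)
    linarith
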